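/- arXiv:0903.3007 — 2 statements merged into one kernel-verified Lean document; each statement's English description precedes it below -/
import Mathlib

section
/- For s ∈ ℂ with Re(s) > 1, the function x ↦ Σ_{n=1}^∞ (x+n)^{-s} satisfies Σ_{n=1}^∞ (x+n)^{-s} ~ x^{1-s}/(s-1) as x → ∞, i.e., the ratio of the two sides tends to 1. -/
open Filter Topology

/-- Mean value estimate for the antiderivative `y ↦ y ^ (1 - s) / (1 - s)` of `y ↦ y ^ (-s)`. -/
theorem norm_cpow_neg_add_one_sub_le (s : ℂ) (hs : 1 < s.re) {y : ℝ} (hy : 0 < y) :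
    ‖((y + 1 : ℝ) : ℂ) ^ (-s) -
      (((y + 1 : ℝ) : ℂ) ^ (1 - s) / (1 - s) - (y : ℂ) ^ (1 - s) / (1 - s))‖ ≤
      ‖s‖ * y ^ (-s.re - 1) := by
  have hs0 : s ≠ 0 := by rintro rfl; norm_num at hs
  have hs1 : s ≠ 1 := by rintro rfl; norm_num at hs
  have hmem : y + 1 ∈ Set.Icc y (y + 1) := ⟨by linarith, le_rfl⟩
  have hmem' : y ∈ Set.Icc y (y + 1) := ⟨le_rfl, by linarith⟩
  have hpow : ∀ t ∈ Set.Icc y (y + 1), ‖(t : ℂ) ^ (-s) - ((y + 1 : ℝ) : ℂ) ^ (-s)‖ ≤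
      ‖s‖ * y ^ (-s.re - 1) := by
    intro t ht
    have hderiv : ∀ u ∈ Set.Icc y (y + 1), HasDerivWithinAt (fun u : ℝ => (u : ℂ) ^ (-s))
        (-s * (u : ℂ) ^ (-s - 1)) (Set.Icc y (y + 1)) u := by
      intro u hu
      have hu0 : u ≠ 0 := (hy.trans_le hu.1).ne'
      exact (hasDerivAt_ofReal_cpow_const hu0 (neg_ne_zero.mpr hs0)).hasDerivWithinAt
    have hbound : ∀ u ∈ Set.Icc y (y + 1), ‖-s * (u : ℂ) ^ (-s - 1)‖ ≤
        ‖s‖ * y ^ (-s.re - 1) := by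
      intro u hu
      rw [norm_mul, norm_neg, Complex.norm_cpow_eq_rpow_re_of_pos (hy.trans_le hu.1)]
      simp only [Complex.sub_re, Complex.neg_re, Complex.one_re]
      exact mul_le_mul_of_nonneg_left
        (Real.rpow_le_rpow_of_nonpos hy hu.1 (by linarith)) (norm_nonneg _)
    have hmvt := (convex_Icc y (y + 1)).norm_image_sub_le_of_norm_hasDerivWithin_le
      hderiv hbound hmem ht
    have hdist : ‖t - (y + 1)‖ ≤ 1 := by
      rw [Real.norm_eq_abs, abs_le]; constructor <;> linarith [ht.1, ht.2]
    exact hmvt.trans (mul_le_of_le_one_right (by positivity) hdist)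
  have hderiv : ∀ t ∈ Set.Icc y (y + 1), HasDerivWithinAt
      (fun t : ℝ => (t : ℂ) ^ (1 - s) / (1 - s) - t * ((y + 1 : ℝ) : ℂ) ^ (-s))
      ((t : ℂ) ^ (-s) - ((y + 1 : ℝ) : ℂ) ^ (-s)) (Set.Icc y (y + 1)) t := by
    intro t ht
    have ht0 : t ≠ 0 := (hy.trans_le ht.1).ne'
    have hF := hasDerivAt_ofReal_cpow_const' ht0 (r := -s) (by simpa using hs1)
    rw [show -s + 1 = 1 - s by ring] at hF
    have hlin := (Complex.ofRealCLM.hasDerivAt (x := t)).mul_const (((y + 1 : ℝ) : ℂ) ^ (-s))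
    simp only [Complex.ofRealCLM_apply, Complex.ofReal_one, one_mul] at hlin
    exact (hF.sub hlin).hasDerivWithinAt
  have hmvt := (convex_Icc y (y + 1)).norm_image_sub_le_of_norm_hasDerivWithin_le
    hderiv hpow hmem' hmem
  rw [show y + 1 - y = 1 by ring, norm_one, mul_one] at hmvt
  rw [← norm_neg]
  refine le_of_eq_of_le (congrArg _ ?_) hmvt
  push_cast
  ring

/-- Summing the mean value estimate over the translates `x + n`. -/
theorem norm_tsum_cpow_neg_sub_le (s : ℂ) (hs : 1 < s.re) {x : ℝ} (hx : 1 ≤ x) :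
    ‖(∑' n : ℕ, ((x + n + 1 : ℝ) : ℂ) ^ (-s)) - (x : ℂ) ^ (1 - s) / (s - 1)‖ ≤
      (‖s‖ * ∑' n : ℕ, ((n : ℝ) + 1) ^ (-(3 / 2) : ℝ)) * x ^ (1 / 2 - s.re) := by
  have hsummable : ∀ p : ℝ, 1 < p → Summable fun n : ℕ => ((n : ℝ) + 1) ^ (-p) := by
    intro p hp
    have := (summable_nat_add_iff 1).mpr (Real.summable_nat_rpow.mpr (neg_lt_neg hp))
    simpa using this
  have hpos : ∀ n : ℕ, 0 < x + n := fun n => by positivity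
  set a : ℕ → ℂ := fun n => ((x + n + 1 : ℝ) : ℂ) ^ (-s) with ha
  set G : ℕ → ℂ := fun n => ((x + n : ℝ) : ℂ) ^ (1 - s) / (1 - s) with hG
  have hasum : Summable a := by
    refine Summable.of_norm_bounded (hsummable _ hs) fun n => ?_
    rw [ha, Complex.norm_cpow_eq_rpow_re_of_pos (by linarith [hpos n]), Complex.neg_re]
    exact Real.rpow_le_rpow_of_nonpos (by positivity) (by linarith) (by linarith)
  have herr : ∀ n, ‖a n - (G (n + 1) - G n)‖ ≤
      ‖s‖ * x ^ (1 / 2 - s.re) * ((n : ℝ) + 1) ^ (-(3 / 2) : ℝ) := by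
    intro n
    have h := norm_cpow_neg_add_one_sub_le s hs (hpos n)
    have hGn : G (n + 1) = ((x + n + 1 : ℝ) : ℂ) ^ (1 - s) / (1 - s) := by
      simp only [hG]; push_cast; ring_nf
    rw [hGn]
    refine h.trans ?_
    rw [mul_assoc, show -s.re - 1 = (1 / 2 - s.re) + (-(3 / 2)) by ring,
      Real.rpow_add (hpos n)]
    have h1 : (x + n) ^ (1 / 2 - s.re) ≤ x ^ (1 / 2 - s.re) :=
      Real.rpow_le_rpow_of_nonpos (by linarith) (by simp) (by linarith)
    have h2 : (x + n) ^ (-(3 / 2) : ℝ) ≤ ((n : ℝ) + 1) ^ (-(3 / 2) : ℝ) :=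
      Real.rpow_le_rpow_of_nonpos (by positivity) (by linarith) (by norm_num)
    have := hpos n
    gcongr
  have hbsum : Summable fun n : ℕ =>
      ‖s‖ * x ^ (1 / 2 - s.re) * ((n : ℝ) + 1) ^ (-(3 / 2) : ℝ) :=
    (hsummable (3 / 2) (by norm_num)).mul_left _
  have hesum : Summable fun n => a n - (G (n + 1) - G n) := .of_norm_bounded hbsum herr
  have hdsum : Summable fun n => G (n + 1) - G n := by
    simpa using hasum.sub hesum
  have hGlim : Tendsto G atTop (𝓝 0) := by
    rw [tendsto_zero_iff_norm_tendsto_zero]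
    have hshift : Tendsto (fun n : ℕ => x + n) atTop atTop :=
      tendsto_atTop_add_const_left _ _ tendsto_natCast_atTop_atTop
    have hlim := ((tendsto_rpow_neg_atTop (sub_pos.mpr hs)).comp hshift).div_const ‖1 - s‖
    rw [zero_div] at hlim
    refine hlim.congr fun n => ?_
    simp only [hG, Function.comp_apply]
    rw [norm_div, Complex.norm_cpow_eq_rpow_re_of_pos (hpos n)]
    simp
  have hdtsum : ∑' n, (G (n + 1) - G n) = (x : ℂ) ^ (1 - s) / (s - 1) := by
    refine tendsto_nhds_unique hdsum.hasSum.tendsto_sum_nat ?_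
    simp only [Finset.sum_range_sub]
    convert hGlim.sub_const (G 0) using 2
    simp only [hG, Nat.cast_zero, add_zero]
    rw [zero_sub, ← div_neg, neg_sub]
  rw [← hdtsum, ← hasum.tsum_sub hdsum]
  calc _ ≤ _ := tsum_of_norm_bounded hbsum.hasSum herr
    _ = _ := by rw [tsum_mul_left]; ring

theorem stmt_9 (s : ℂ) (hs : 1 < s.re) :
    Tendsto (fun x : ℝ =>
        (∑' n : ℕ+, ((x : ℂ) + (n : ℕ)) ^ (-s)) / ((x : ℂ) ^ (1 - s) / (s - 1)))
      atTop (𝓝 1) := by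
  have hs1 : s - 1 ≠ 0 := by
    rw [sub_ne_zero]; rintro rfl; norm_num at hs
  set C : ℝ := ‖s‖ * ∑' n : ℕ, ((n : ℝ) + 1) ^ (-(3 / 2) : ℝ) with hC
  have hlim : Tendsto (fun x : ℝ => C * ‖s - 1‖ * x ^ (-(1 / 2) : ℝ)) atTop (𝓝 0) := by
    simpa using (tendsto_rpow_neg_atTop (y := 1 / 2) (by norm_num)).const_mul (C * ‖s - 1‖)
  rw [tendsto_iff_norm_sub_tendsto_zero]
  refine squeeze_zero' (.of_forall fun _ => norm_nonneg _) ?_ hlim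
  filter_upwards [eventually_ge_atTop 1] with x hx
  have hx0 : 0 < x := by linarith
  have hF : (x : ℂ) ^ (1 - s) / (s - 1) ≠ 0 :=
    div_ne_zero (by simp [Complex.cpow_eq_zero_iff, hx0.ne']) hs1
  have hsum : ∑' n : ℕ+, ((x : ℂ) + (n : ℕ)) ^ (-s) =
      ∑' n : ℕ, ((x + n + 1 : ℝ) : ℂ) ^ (-s) := by
    rw [tsum_pnat_eq_tsum_succ (f := fun n : ℕ => ((x : ℂ) + n) ^ (-s))]
    push_cast
    simp only [add_assoc]
  rw [hsum, div_sub_one hF, norm_div, div_le_iff₀ (norm_pos_iff.mpr hF)]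
  refine (norm_tsum_cpow_neg_sub_le s hs hx).trans_eq ?_
  rw [norm_div, Complex.norm_cpow_eq_rpow_re_of_pos hx0, ← hC, Complex.sub_re, Complex.one_re,
    show 1 / 2 - s.re = -(1 / 2) + (1 - s.re) by ring, Real.rpow_add hx0]
  have := norm_ne_zero_iff.mpr hs1
  field_simp
end

section
/- For fixed real a ≤ b, there exist constants C₁, C₂ > 0 and T > 0 such that for all σ ∈ [a,b] and |τ| ≥ T: C₁ |τ|^{σ - 1/2} e^{-π|τ|/2} ≤ |Γ(σ + iτ)| ≤ C₂ |τ|^{σ - 1/2} e^{-π|τ|/2}. -/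
open Real Complex

/-- On the right half-plane, `|Γ(s)| ≤ Γ(re s)`. -/
theorem norm_Gamma_le_Gamma_re {s : ℂ} (hs : 0 < s.re) : ‖Complex.Gamma s‖ ≤ Real.Gamma s.re := by
  rw [Complex.Gamma_eq_integral hs, Real.Gamma_eq_integral hs, Complex.GammaIntegral]
  refine (MeasureTheory.norm_integral_le_integral_norm _).trans_eq ?_
  refine MeasureTheory.setIntegral_congr_fun measurableSet_Ioi fun x hx => ?_
  simp only [norm_mul, Complex.norm_cpow_eq_rpow_re_of_pos (Set.mem_Ioi.mp hx), Complex.norm_real,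
    Real.norm_eq_abs, Real.abs_exp, Complex.sub_re, Complex.one_re]

theorem norm_Gamma_half_add_mul_I_sq (τ : ℝ) :
    ‖Complex.Gamma (1 / 2 + τ * I)‖ ^ 2 = π / Real.cosh (π * τ) := by
  have hconj : (1 : ℂ) - (1 / 2 + τ * I) = (starRingEnd ℂ) (1 / 2 + τ * I) := by
    apply Complex.ext <;> simp
    norm_num
  have hsin : Complex.sin (π * (1 / 2 + τ * I)) = (Real.cosh (π * τ) : ℝ) := by
    rw [show (π : ℂ) * (1 / 2 + τ * I) = (π * τ : ℂ) * I + π / 2 by ring,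
      Complex.sin_add_pi_div_two, Complex.cos_mul_I]
    simp
  have h := congrArg norm (Complex.Gamma_mul_Gamma_one_sub (1 / 2 + τ * I))
  rw [hconj, Complex.Gamma_conj, norm_mul, Complex.norm_conj, hsin, norm_div, Complex.norm_real,
    Complex.norm_real, Real.norm_of_nonneg pi_pos.le,
    Real.norm_of_nonneg (Real.cosh_pos _).le] at h
  rw [sq, h]

theorem norm_Gamma_half_add_mul_I_mul_exp_le (τ : ℝ) :
    ‖Complex.Gamma (1 / 2 + τ * I)‖ * Real.exp (π / 2 * τ) ≤ √(2 * π) := by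
  apply Real.le_sqrt_of_sq_le
  rw [mul_pow, norm_Gamma_half_add_mul_I_sq, ← Real.exp_nat_mul, div_mul_eq_mul_div,
    div_le_iff₀ (Real.cosh_pos _), Real.cosh_eq,
    show ((2 : ℕ) : ℝ) * (π / 2 * τ) = π * τ by push_cast; ring]
  nlinarith [mul_pos pi_pos (Real.exp_pos (-(π * τ)))]

/-- The auxiliary function to which the Phragmén–Lindelöf principle is applied. -/
noncomputable def gammaStripAux (T : ℝ) (s : ℂ) : ℂ :=
  Complex.Gamma s * Complex.exp (-(π / 2) * I * s) * (T : ℂ) ^ (1 / 2 - s) * (T / (s + T))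

theorem norm_gammaStripAux {T : ℝ} (hT : 0 < T) (s : ℂ) :
    ‖gammaStripAux T s‖ = ‖Complex.Gamma s‖ * Real.exp (π / 2 * s.im) * T ^ (1 / 2 - s.re) *
      (T / ‖s + T‖) := by
  rw [gammaStripAux, norm_mul, norm_mul, norm_mul, Complex.norm_exp,
    Complex.norm_cpow_eq_rpow_re_of_pos hT, norm_div, Complex.norm_real, Real.norm_of_nonneg hT.le]
  congr 4
  · simp
  · simp

theorem le_norm_add_ofReal {T : ℝ} {s : ℂ} (hs : 0 ≤ s.re) : T ≤ ‖s + T‖ := by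
  have := Complex.re_le_norm (s + T)
  simp at this
  linarith

theorem differentiableAt_gammaStripAux {T : ℝ} (hT : 0 < T) {s : ℂ} (hs : 0 < s.re) :
    DifferentiableAt ℂ (gammaStripAux T) s := by
  have hΓ : DifferentiableAt ℂ Complex.Gamma s := by
    refine Complex.differentiableAt_Gamma s fun m hm => ?_
    have : (0 : ℝ) ≤ m := m.cast_nonneg
    rw [hm] at hs
    simp at hs
    linarith
  have hne : s + T ≠ 0 := norm_pos_iff.mp (hT.trans_le (le_norm_add_ofReal hs.le))
  have hT' : (T : ℂ) ≠ 0 := Complex.ofReal_ne_zero.mpr hT.ne'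
  unfold gammaStripAux
  refine ((hΓ.mul (by fun_prop)).mul ?_).mul ?_
  · exact DifferentiableAt.const_cpow (by fun_prop) (Or.inl hT')
  · exact (differentiableAt_const _).div (by fun_prop) hne

theorem norm_gammaStripAux_le {T : ℝ} (hT : 1 ≤ T) {s : ℂ} (h₁ : 1 / 2 ≤ s.re)
    (h₂ : s.re ≤ 3 / 2) : ‖gammaStripAux T s‖ ≤ √(2 * π) := by
  have hT0 : 0 < T := one_pos.trans_le hT
  have hfrac : ∀ z : ℂ, 0 ≤ z.re → T / ‖z + T‖ ≤ 1 := fun z hz =>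
    div_le_one_of_le₀ (le_norm_add_ofReal hz) (norm_nonneg _)
  refine PhragmenLindelof.vertical_strip (a := 1 / 2) (b := 3 / 2) ?_ ?_ ?_ ?_ h₁ h₂
  · refine DifferentiableOn.diffContOnCl fun z hz => ?_
    have hz' : 1 / 2 ≤ z.re := by
      have hsub : closure (re ⁻¹' Set.Ioo (1 / 2) (3 / 2)) ⊆ re ⁻¹' Set.Ici (1 / 2 : ℝ) :=
        closure_minimal (fun w hw => hw.1.le) (isClosed_Ici.preimage Complex.continuous_re)
      exact hsub hz
    exact (differentiableAt_gammaStripAux hT0 (by linarith)).differentiableWithinAt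
  · obtain ⟨M, hM⟩ := (isCompact_Icc (a := (1 / 2 : ℝ)) (b := 3 / 2)).exists_bound_of_continuousOn
      (Real.differentiableOn_Gamma_Ioi.continuousOn.mono fun x hx =>
        Set.mem_Ioi.mpr (by linarith [hx.1]))
    refine ⟨1, by norm_num; linarith [pi_gt_three], π / 2, ?_⟩
    refine Asymptotics.IsBigO.of_bound M (Filter.eventually_inf_principal.mpr
      (Filter.Eventually.of_forall fun z hz => ?_))
    have hz₁ : 1 / 2 < z.re := hz.1
    have hz₂ : z.re < 3 / 2 := hz.2
    have hΓ : ‖Complex.Gamma z‖ ≤ M :=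
      (norm_Gamma_le_Gamma_re (by linarith)).trans
        ((le_abs_self _).trans (hM _ ⟨hz₁.le, hz₂.le⟩))
    have hexp : Real.exp (π / 2 * z.im) ≤ Real.exp (π / 2 * Real.exp (1 * |z.im|)) := by
      gcongr
      linarith [le_abs_self z.im, Real.add_one_le_exp (1 * |z.im|)]
    have hpow : T ^ (1 / 2 - z.re) ≤ 1 := Real.rpow_le_one_of_one_le_of_nonpos hT (by linarith)
    have hM0 : 0 ≤ M := (norm_nonneg _).trans hΓ
    rw [norm_gammaStripAux hT0, Real.norm_of_nonneg (Real.exp_pos _).le]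
    calc ‖Complex.Gamma z‖ * Real.exp (π / 2 * z.im) * T ^ (1 / 2 - z.re) * (T / ‖z + T‖)
        ≤ M * Real.exp (π / 2 * Real.exp (1 * |z.im|)) * 1 * 1 := by
          gcongr
          exact hfrac z (by linarith)
      _ = _ := by ring
  · intro z hz
    have hz' : z = 1 / 2 + z.im * I := by
      apply Complex.ext <;> simp [hz]
    have h := norm_Gamma_half_add_mul_I_mul_exp_le z.im
    rw [← hz'] at h
    rw [norm_gammaStripAux hT0, hz, sub_self, Real.rpow_zero, mul_one]
    calc _ ≤ √(2 * π) * 1 := by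
          gcongr
          exact hfrac z (by rw [hz]; norm_num)
      _ = _ := mul_one _
  · intro z hz
    set w : ℂ := 1 / 2 + z.im * I with hw
    have hw0 : w ≠ 0 := fun h => by simpa [w] using congrArg Complex.re h
    have hz' : z = w + 1 := by
      apply Complex.ext <;> simp [hz, w]
      norm_num
    have h := norm_Gamma_half_add_mul_I_mul_exp_le z.im
    rw [← hw] at h
    have hΓ : ‖Complex.Gamma z‖ = ‖w‖ * ‖Complex.Gamma w‖ := by
      rw [hz', Complex.Gamma_add_one _ hw0, norm_mul]
    have hle : ‖w‖ ≤ ‖z + T‖ := by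
      rw [← sq_le_sq₀ (norm_nonneg _) (norm_nonneg _), ← Complex.normSq_eq_norm_sq,
        ← Complex.normSq_eq_norm_sq, Complex.normSq_apply, Complex.normSq_apply]
      simp [w, hz]
      nlinarith
    have hpos : 0 < ‖z + T‖ := hT0.trans_le (le_norm_add_ofReal (by rw [hz]; norm_num))
    rw [norm_gammaStripAux hT0, hz, hΓ, show (1 / 2 - 3 / 2 : ℝ) = -1 by norm_num,
      Real.rpow_neg_one]
    calc _ = ‖Complex.Gamma w‖ * Real.exp (π / 2 * z.im) * (‖w‖ / ‖z + T‖) := by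
          field_simp
      _ ≤ √(2 * π) * 1 := by
          gcongr
          exact div_le_one_of_le₀ hle hpos.le
      _ = _ := mul_one _

theorem norm_Gamma_le_of_mem_strip {σ τ : ℝ} (hσ : σ ∈ Set.Icc (1 / 2) (3 / 2)) (hτ : 1 ≤ τ) :
    ‖Complex.Gamma (σ + τ * I)‖ ≤
      4 * √(2 * π) * τ ^ (σ - 1 / 2) * Real.exp (-(π * τ) / 2) := by
  have hτ0 : 0 < τ := one_pos.trans_le hτ
  have h := norm_gammaStripAux_le hτ (s := σ + τ * I) (by simpa using hσ.1) (by simpa using hσ.2)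
  rw [norm_gammaStripAux hτ0] at h
  have hre : ((σ : ℂ) + τ * I).re = σ := by simp
  have him : ((σ : ℂ) + τ * I).im = τ := by simp
  rw [hre, him] at h
  have hpos : 0 < ‖(σ : ℂ) + τ * I + τ‖ :=
    hτ0.trans_le (le_norm_add_ofReal (by rw [hre]; linarith [hσ.1]))
  have hle : ‖(σ : ℂ) + τ * I + τ‖ ≤ 4 * τ := by
    have h₁ : ‖(σ : ℂ)‖ = σ := by
      rw [Complex.norm_real, Real.norm_of_nonneg (by linarith [hσ.1])]
    have h₂ : ‖(τ : ℂ)‖ = τ := by rw [Complex.norm_real, Real.norm_of_nonneg hτ0.le]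
    calc _ ≤ ‖(σ : ℂ)‖ + ‖(τ : ℂ) * I‖ + ‖(τ : ℂ)‖ := norm_add₃_le
      _ = σ + τ + τ := by rw [norm_mul, Complex.norm_I, mul_one, h₁, h₂]
      _ ≤ _ := by linarith [hσ.2]
  have hfrac : 1 / 4 ≤ τ / ‖(σ : ℂ) + τ * I + τ‖ := by
    rw [le_div_iff₀ hpos]
    linarith
  have hpow : τ ^ (1 / 2 - σ) * τ ^ (σ - 1 / 2) = 1 := by
    rw [← Real.rpow_add hτ0]
    simp
  have hexp : Real.exp (π / 2 * τ) * Real.exp (-(π * τ) / 2) = 1 := by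
    rw [← Real.exp_add, ← Real.exp_zero]
    ring_nf
  have h' : ‖Complex.Gamma (σ + τ * I)‖ * Real.exp (π / 2 * τ) * τ ^ (1 / 2 - σ) ≤
      4 * √(2 * π) := by
    have : ‖Complex.Gamma (σ + τ * I)‖ * Real.exp (π / 2 * τ) * τ ^ (1 / 2 - σ) * (1 / 4) ≤
        √(2 * π) := le_trans (by gcongr) h
    linarith
  calc ‖Complex.Gamma (σ + τ * I)‖
      = ‖Complex.Gamma (σ + τ * I)‖ * (Real.exp (π / 2 * τ) * Real.exp (-(π * τ) / 2)) *
          (τ ^ (1 / 2 - σ) * τ ^ (σ - 1 / 2)) := by rw [hexp, hpow]; ring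
    _ = ‖Complex.Gamma (σ + τ * I)‖ * Real.exp (π / 2 * τ) * τ ^ (1 / 2 - σ) *
          τ ^ (σ - 1 / 2) * Real.exp (-(π * τ) / 2) := by ring
    _ ≤ _ := by gcongr

theorem norm_Gamma_ofReal_add_abs_mul_I (σ τ : ℝ) :
    ‖Complex.Gamma (σ + (|τ| : ℝ) * I)‖ = ‖Complex.Gamma (σ + τ * I)‖ := by
  rcases abs_cases τ with ⟨h, -⟩ | ⟨h, -⟩
  · rw [h]
  · rw [h, show ((σ : ℂ) + (-τ : ℝ) * I) = (starRingEnd ℂ) (σ + τ * I) by simp,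
      Complex.Gamma_conj, Complex.norm_conj]

theorem exists_norm_Gamma_le_of_mem_Icc_nat (n : ℕ) :
    ∃ C : ℝ, 0 < C ∧ ∀ σ τ : ℝ, σ ∈ Set.Icc (1 / 2 - n : ℝ) (3 / 2 + n) → 1 ≤ τ →
      ‖Complex.Gamma (σ + τ * I)‖ ≤ C * τ ^ (σ - 1 / 2) * Real.exp (-(π * τ) / 2) := by
  induction n with
  | zero =>
    refine ⟨4 * √(2 * π), by positivity, fun σ τ hσ hτ => ?_⟩
    exact norm_Gamma_le_of_mem_strip (by simpa using hσ) hτ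
  | succ n ih =>
    obtain ⟨C, hC, ih⟩ := ih
    have hn : (0 : ℝ) ≤ n := n.cast_nonneg
    refine ⟨(n + 3) * C, by positivity, fun σ τ hσ hτ => ?_⟩
    have hτ0 : 0 < τ := one_pos.trans_le hτ
    have hσ₁ : 1 / 2 - (n + 1 : ℝ) ≤ σ := by simpa using hσ.1
    have hσ₂ : σ ≤ 3 / 2 + (n + 1 : ℝ) := by simpa using hσ.2
    have hstep : ∀ x : ℝ, ‖Complex.Gamma ((x + 1 : ℝ) + τ * I)‖ =
        ‖(x : ℂ) + τ * I‖ * ‖Complex.Gamma (x + τ * I)‖ := by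
      intro x
      have hne : (x : ℂ) + τ * I ≠ 0 := fun h => hτ0.ne' (by simpa using congrArg Complex.im h)
      rw [← norm_mul, ← Complex.Gamma_add_one _ hne]
      congr 2
      push_cast
      ring
    rcases lt_or_ge σ (1 / 2) with h | h
    · have hs := ih (σ + 1) τ ⟨by linarith, by linarith⟩ hτ
      rw [hstep, show σ + 1 - 1 / 2 = 1 + (σ - 1 / 2) by ring, Real.rpow_add hτ0,
        Real.rpow_one] at hs
      have him : τ ≤ ‖(σ : ℂ) + τ * I‖ := by
        simpa using Complex.im_le_norm ((σ : ℂ) + τ * I)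
      have hs' : τ * ‖Complex.Gamma (σ + τ * I)‖ ≤
          τ * (C * τ ^ (σ - 1 / 2) * Real.exp (-(π * τ) / 2)) := by
        calc _ ≤ ‖(σ : ℂ) + τ * I‖ * ‖Complex.Gamma (σ + τ * I)‖ := by gcongr
          _ ≤ _ := hs
          _ = _ := by ring
      refine (le_of_mul_le_mul_left hs' hτ0).trans ?_
      gcongr
      nlinarith
    · rcases lt_or_ge (3 / 2) σ with h' | h'
      · have hs := ih (σ - 1) τ ⟨by linarith, by linarith⟩ hτ
        have hst := hstep (σ - 1)
        rw [sub_add_cancel] at hst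
        have hnorm : ‖((σ - 1 : ℝ) : ℂ) + τ * I‖ ≤ (n + 3) * τ := by
          calc _ ≤ ‖((σ - 1 : ℝ) : ℂ)‖ + ‖(τ : ℂ) * I‖ := norm_add_le _ _
            _ = (σ - 1) + τ := by
              rw [norm_mul, Complex.norm_I, mul_one, Complex.norm_real, Complex.norm_real,
                Real.norm_of_nonneg (by linarith), Real.norm_of_nonneg hτ0.le]
            _ ≤ _ := by nlinarith
        have hpow : τ ^ (σ - 1 / 2) = τ * τ ^ (σ - 1 - 1 / 2) := by
          rw [show σ - 1 / 2 = 1 + (σ - 1 - 1 / 2) by ring, Real.rpow_add hτ0, Real.rpow_one]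
        rw [hst, hpow]
        calc _ ≤ ((n + 3) * τ) * (C * τ ^ (σ - 1 - 1 / 2) * Real.exp (-(π * τ) / 2)) := by
              gcongr
          _ = _ := by ring
      · refine (ih σ τ ⟨by linarith, by linarith⟩ hτ).trans ?_
        gcongr
        nlinarith

theorem exists_norm_Gamma_le_of_mem_Icc (a b : ℝ) :
    ∃ C : ℝ, 0 < C ∧ ∀ σ τ : ℝ, σ ∈ Set.Icc a b → 1 ≤ |τ| →
      ‖Complex.Gamma (σ + τ * I)‖ ≤ C * |τ| ^ (σ - 1 / 2) * Real.exp (-(π * |τ|) / 2) := by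
  obtain ⟨n, hn⟩ := exists_nat_ge (max |a| |b|)
  have ha : |a| ≤ n := (le_max_left _ _).trans hn
  have hb : |b| ≤ n := (le_max_right _ _).trans hn
  obtain ⟨C, hC, h⟩ := exists_norm_Gamma_le_of_mem_Icc_nat (n + 1)
  refine ⟨C, hC, fun σ τ hσ hτ => ?_⟩
  rw [← norm_Gamma_ofReal_add_abs_mul_I]
  refine h σ |τ| ⟨?_, ?_⟩ hτ
  · push_cast
    linarith [neg_abs_le a, hσ.1]
  · push_cast
    linarith [le_abs_self b, hσ.2]

theorem norm_sin_le_exp_abs_im (z : ℂ) : ‖Complex.sin z‖ ≤ Real.exp |z.im| := by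
  have h₁ : ‖Complex.exp (-z * I)‖ ≤ Real.exp |z.im| := by
    rw [Complex.norm_exp]
    simpa using le_abs_self z.im
  have h₂ : ‖Complex.exp (z * I)‖ ≤ Real.exp |z.im| := by
    rw [Complex.norm_exp]
    simpa using neg_le_abs z.im
  rw [Complex.sin, norm_div, norm_mul, Complex.norm_I, mul_one, Complex.norm_two]
  linarith [norm_sub_le (Complex.exp (-z * I)) (Complex.exp (z * I))]

theorem stmt_16 (a b : ℝ) (hab : a ≤ b) :
    ∃ C₁ C₂ T : ℝ, 0 < C₁ ∧ 0 < C₂ ∧ 0 < T ∧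
      ∀ σ τ : ℝ, σ ∈ Set.Icc a b → T ≤ |τ| →
        C₁ * |τ| ^ (σ - 1 / 2) * Real.exp (-(π * |τ|) / 2) ≤
          ‖Complex.Gamma (σ + τ * Complex.I)‖ ∧
        ‖Complex.Gamma (σ + τ * Complex.I)‖ ≤
          C₂ * |τ| ^ (σ - 1 / 2) * Real.exp (-(π * |τ|) / 2) := by
  obtain ⟨C, hC, hup⟩ := exists_norm_Gamma_le_of_mem_Icc a b
  obtain ⟨D, hD, hrefl⟩ := exists_norm_Gamma_le_of_mem_Icc (1 - b) (1 - a)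
  refine ⟨π / D, C, 1, by positivity, hC, one_pos, fun σ τ hσ hτ => ⟨?_, hup σ τ hσ hτ⟩⟩
  have hτ0 : 0 < |τ| := one_pos.trans_le hτ
  set s : ℂ := σ + τ * I
  have hΓ : ‖Complex.Gamma (1 - s)‖ ≤
      D * |τ| ^ (1 / 2 - σ) * Real.exp (-(π * |τ|) / 2) := by
    have h := hrefl (1 - σ) (-τ) ⟨by linarith [hσ.2], by linarith [hσ.1]⟩ (by rwa [abs_neg])
    rw [abs_neg, show 1 - σ - 1 / 2 = 1 / 2 - σ by ring] at h
    convert h using 3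
    push_cast
    ring
  have hsin : ‖Complex.sin (π * s)‖ ≤ Real.exp (π * |τ|) := by
    refine (norm_sin_le_exp_abs_im _).trans_eq ?_
    simp [s, abs_mul, abs_of_pos pi_pos]
  have hsin0 : Complex.sin (π * s) ≠ 0 := by
    rw [Ne, Complex.sin_eq_zero_iff]
    rintro ⟨k, hk⟩
    have := congrArg Complex.im hk
    simp [s, pi_ne_zero] at this
    simp [this] at hτ0
  have hprod : ‖Complex.Gamma s‖ * ‖Complex.Gamma (1 - s)‖ * ‖Complex.sin (π * s)‖ = π := by
    rw [← norm_mul, ← norm_mul, Complex.Gamma_mul_Gamma_one_sub, div_mul_cancel₀ _ hsin0,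
      Complex.norm_real, Real.norm_of_nonneg pi_pos.le]
  have hpow : |τ| ^ (1 / 2 - σ) * |τ| ^ (σ - 1 / 2) = 1 := by
    rw [← Real.rpow_add hτ0]
    simp
  have hexp : Real.exp (-(π * |τ|) / 2) * Real.exp (π * |τ|) * Real.exp (-(π * |τ|) / 2) = 1 := by
    rw [← Real.exp_add, ← Real.exp_add, ← Real.exp_zero]
    ring_nf
  have hle : π ≤ ‖Complex.Gamma s‖ * (D * |τ| ^ (1 / 2 - σ) * Real.exp (-(π * |τ|) / 2)) *
      Real.exp (π * |τ|) := by
    refine hprod.ge.trans ?_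
    gcongr
  calc π / D * |τ| ^ (σ - 1 / 2) * Real.exp (-(π * |τ|) / 2)
      ≤ (‖Complex.Gamma s‖ * (D * |τ| ^ (1 / 2 - σ) * Real.exp (-(π * |τ|) / 2)) *
        Real.exp (π * |τ|)) / D * |τ| ^ (σ - 1 / 2) * Real.exp (-(π * |τ|) / 2) := by gcongr
    _ = ‖Complex.Gamma s‖ * (|τ| ^ (1 / 2 - σ) * |τ| ^ (σ - 1 / 2)) *
        (Real.exp (-(π * |τ|) / 2) * Real.exp (π * |τ|) * Real.exp (-(π * |τ|) / 2)) := by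
      field_simp
    _ = ‖Complex.Gamma s‖ := by rw [hpow, hexp, mul_one, mul_one]
end
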